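/- arXiv:0709.2330 — 2 statements merged into one kernel-verified Lean document; each statement's English description precedes it below -/
import Mathlib

section
/- Define Y_n(ω) = 1 if T^n ω ∈ C and 0 otherwise, where C is as constructed. Then (Y_n) is a stationary ergodic binary process with E[Y_1] ≤ 1/2, and for every ω ∈ A_i one has Y_0(ω) = Y_{-1}(ω) = ... = Y_{-(2^{i-1}-1)}(ω) = 1. -/
open MeasureTheory

noncomputable def binDigit (i : ℕ) (r : ℝ) : ℤ := ⌊r * 2 ^ i⌋ % 2

noncomputable def binTau (r : ℝ) : ℕ := sInf {i | 0 < i ∧ binDigit i r = 1}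

/-- The binary odometer `T r = r - 2^{-τ(r)} + ∑_{l=1}^{τ(r)-1} 2^{-l}`. -/
noncomputable def TOdo (r : ℝ) : ℝ :=
  r - (2 : ℝ)⁻¹ ^ binTau r + ∑ l ∈ Finset.Icc 1 (binTau r - 1), (2 : ℝ)⁻¹ ^ l

/-- `Jset i j = [0,1) ∩ T^{-j} [0, 2^{-(2i+1)})`, i.e. the part of the `j`-th
preimage of `I_0^{2i+1}` inside the unit interval. -/
noncomputable def Jset (i j : ℕ) : Set ℝ :=
  Set.Ico (0 : ℝ) 1 ∩ (TOdo^[j] ⁻¹' Set.Ico (0 : ℝ) ((2 : ℝ)⁻¹ ^ (2 * i + 1)))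

/-- `A_0 = ∅`, and for `i ≥ 1`, `A_i = ⋃_{j=0}^{2^{i-1}-1} T^{-j} [0, 2^{-2i-1})`. -/
noncomputable def Aset : ℕ → Set ℝ
  | 0 => ∅
  | i + 1 => ⋃ j ∈ Finset.range (2 ^ i), Jset (i + 1) j

/-- `B_0 = [0, 1/4)`, and for `i ≥ 1`, `B_i = ⋃_{j=2^{i-1}}^{2^i-1} T^{-j} [0, 2^{-2i-1})`. -/
noncomputable def Bset : ℕ → Set ℝ
  | 0 => Set.Ico (0 : ℝ) (1 / 4)
  | i + 1 => ⋃ j ∈ Finset.Ico (2 ^ i) (2 ^ (i + 1)), Jset (i + 1) j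

/-- `C_i = A_i ∪ B_i`. -/
noncomputable def Cset (i : ℕ) : Set ℝ := Aset i ∪ Bset i

/-- `C = ⋃_{i ≥ 0} C_i`. -/
noncomputable def CsetAll : Set ℝ := ⋃ i, Cset i

theorem sum_Icc_inv_two_pow (u : ℕ) :
    ∑ l ∈ Finset.Icc 1 u, (2 : ℝ)⁻¹ ^ l = 1 - (2 : ℝ)⁻¹ ^ u := by
  induction u with
  | zero => simp
  | succ u ih =>
    rw [Finset.sum_Icc_succ_top (by omega), ih, pow_succ]
    ring

theorem TOdo_eq (r : ℝ) :
    TOdo r = r - (2 : ℝ)⁻¹ ^ binTau r + (1 - (2 : ℝ)⁻¹ ^ (binTau r - 1)) := by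
  rw [TOdo, sum_Icc_inv_two_pow]

theorem binDigit_succ (i : ℕ) (r : ℝ) : binDigit (i + 1) r = binDigit i (2 * r) := by
  unfold binDigit
  rw [pow_succ]
  congr 2
  ring

theorem binDigit_one_of_half_le {r : ℝ} (h : 1 / 2 ≤ r) (h1 : r < 1) : binDigit 1 r = 1 := by
  have : ⌊r * 2 ^ 1⌋ = 1 := by
    rw [Int.floor_eq_iff]
    constructor <;> push_cast <;> linarith
  rw [binDigit, this]
  rfl

theorem binTau_of_half_le {r : ℝ} (h : 1 / 2 ≤ r) (h1 : r < 1) : binTau r = 1 := by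
  have hmem : (1 : ℕ) ∈ {i | 0 < i ∧ binDigit i r = 1} :=
    ⟨one_pos, binDigit_one_of_half_le h h1⟩
  exact le_antisymm (Nat.sInf_le hmem) (Nat.sInf_mem ⟨_, hmem⟩).1

theorem TOdo_of_half_le {r : ℝ} (h : 1 / 2 ≤ r) (h1 : r < 1) : TOdo r = r - 1 / 2 := by
  rw [TOdo_eq, binTau_of_half_le h h1]
  norm_num

theorem binTau_of_lt_half {r : ℝ} (h0 : 0 ≤ r) (h : r < 1 / 2) (hpos : 0 < binTau (2 * r)) :
    binTau r = binTau (2 * r) + 1 := by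
  have hz : binDigit 0 (2 * r) = 0 := by
    have : ⌊2 * r * 2 ^ 0⌋ = 0 := by
      rw [Int.floor_eq_iff]
      constructor <;> push_cast <;> linarith
    rw [binDigit, this]
    rfl
  have hset : {i | 0 < i ∧ binDigit i (2 * r) = 1} =
      {m | 0 < m + 1 ∧ binDigit (m + 1) r = 1} := by
    ext m
    simp only [Set.mem_ofPred_eq, binDigit_succ]
    rcases Nat.eq_zero_or_pos m with rfl | hm
    · simp [hz]
    · simp [hm]
  have hne : {i | 0 < i ∧ binDigit i (2 * r) = 1}.Nonempty := Nat.nonempty_of_pos_sInf hpos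
  rw [hset] at hne
  obtain ⟨m, hm⟩ := hne
  have hle : 1 ≤ sInf {i | 0 < i ∧ binDigit i r = 1} :=
    (Nat.sInf_mem (s := {i | 0 < i ∧ binDigit i r = 1}) ⟨m + 1, hm⟩).1
  rw [binTau, binTau, hset]
  exact (Nat.sInf_add hle).symm

theorem binTau_pos {r : ℝ} (h0 : 0 < r) (h1 : r < 1) : 0 < binTau r := by
  obtain ⟨n, hn⟩ := exists_pow_lt_of_lt_one h0 (by norm_num : (2 : ℝ)⁻¹ < 1)
  induction n generalizing r with
  | zero => norm_num at hn; linarith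
  | succ n ih =>
    rcases le_or_gt (1 / 2) r with h | h
    · rw [binTau_of_half_le h h1]; exact one_pos
    · rw [binTau_of_lt_half h0.le h (ih (by linarith) (by linarith) ?_)]
      · exact Nat.succ_pos _
      · rw [pow_succ] at hn; linarith

theorem TOdo_of_lt_half {r : ℝ} (h0 : 0 < r) (h : r < 1 / 2) :
    TOdo r = 1 / 2 + TOdo (2 * r) / 2 := by
  have hpos : 0 < binTau (2 * r) := binTau_pos (by linarith) (by linarith)
  rw [TOdo_eq, TOdo_eq, binTau_of_lt_half h0.le h hpos]
  obtain ⟨k, hk⟩ := Nat.exists_eq_succ_of_ne_zero hpos.ne'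
  rw [hk]
  simp only [Nat.succ_eq_add_one, Nat.add_sub_cancel, pow_succ]
  ring

theorem TOdo_mem_Ico {r : ℝ} (h0 : 0 < r) (h1 : r < 1) : TOdo r ∈ Set.Ico (0 : ℝ) 1 := by
  obtain ⟨n, hn⟩ := exists_pow_lt_of_lt_one h0 (by norm_num : (2 : ℝ)⁻¹ < 1)
  induction n generalizing r with
  | zero => norm_num at hn; linarith
  | succ n ih =>
    rcases le_or_gt (1 / 2) r with h | h
    · rw [TOdo_of_half_le h h1]
      constructor <;> linarith
    · have := ih (r := 2 * r) (by linarith) (by linarith) (by rw [pow_succ] at hn; linarith)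
      rw [TOdo_of_lt_half h0 h]
      constructor <;> linarith [this.1, this.2]

theorem measurable_binDigit (i : ℕ) : Measurable (binDigit i) :=
  (measurable_from_top (f := fun z : ℤ => z % 2)).comp
    (Int.measurable_floor.comp (measurable_id.mul_const _))

theorem measurable_binTau : Measurable binTau := by
  have hD : ∀ i, MeasurableSet {r | binDigit i r = 1} := fun i =>
    measurable_binDigit i (MeasurableSet.singleton (1 : ℤ))
  refine measurable_of_Ioi fun n => ?_
  have : binTau ⁻¹' Set.Ioi n =
      (⋂ i ∈ Set.Ioc 0 n, {r | binDigit i r = 1}ᶜ) ∩ ⋃ i ∈ Set.Ioi n, {r | binDigit i r = 1} := by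
    ext r
    simp only [Set.mem_preimage, Set.mem_Ioi, Set.mem_inter_iff, Set.mem_iInter, Set.mem_iUnion,
      Set.mem_compl_iff, Set.mem_ofPred_eq, Set.mem_Ioc, exists_prop]
    constructor
    · intro h
      refine ⟨fun i hi hd => ?_, binTau r, h, ?_⟩
      · have : binTau r ≤ i := Nat.sInf_le ⟨hi.1, hd⟩
        omega
      · exact (Nat.sInf_mem (Nat.nonempty_of_pos_sInf (Nat.zero_lt_of_lt h))).2
    · rintro ⟨h1, i, hi, hd⟩
      have hmem := Nat.sInf_mem (s := {i | 0 < i ∧ binDigit i r = 1}) ⟨i, by omega, hd⟩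
      by_contra hcon
      exact h1 _ ⟨hmem.1, not_lt.mp hcon⟩ hmem.2
  rw [this]
  exact (MeasurableSet.biInter (Set.to_countable _) fun i _ => (hD i).compl).inter
    (MeasurableSet.biUnion (Set.to_countable _) fun i _ => hD i)

theorem measurable_TOdo : Measurable TOdo := by
  have h : TOdo = fun r => r - (2 : ℝ)⁻¹ ^ binTau r + (1 - (2 : ℝ)⁻¹ ^ (binTau r - 1)) :=
    funext TOdo_eq
  rw [h]
  have h1 : Measurable fun r => (2 : ℝ)⁻¹ ^ binTau r :=
    (measurable_from_top (f := fun n : ℕ => (2 : ℝ)⁻¹ ^ n)).comp measurable_binTau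
  have h2 : Measurable fun r => (2 : ℝ)⁻¹ ^ (binTau r - 1) :=
    (measurable_from_top (f := fun n : ℕ => (2 : ℝ)⁻¹ ^ (n - 1))).comp measurable_binTau
  exact (measurable_id.sub h1).add (measurable_const.sub h2)

theorem volume_real_preimage_two_mul (s : Set ℝ) :
    volume.real ((fun r : ℝ => 2 * r) ⁻¹' s) = volume.real s / 2 := by
  rw [Measure.real, Real.volume_preimage_mul_left two_ne_zero, ENNReal.toReal_mul,
    ENNReal.toReal_ofReal (abs_nonneg _), abs_of_pos (by norm_num), Measure.real]
  ring

theorem volume_real_preimage_sub_half (s : Set ℝ) :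
    volume.real ((fun r : ℝ => r - 1 / 2) ⁻¹' s) = volume.real s := by
  simp only [Measure.real, sub_eq_add_neg, measure_preimage_add_right]

theorem volume_inter_Ico_ne_top (s : Set ℝ) (a b : ℝ) : volume (s ∩ Set.Ico a b) ≠ ⊤ :=
  ((measure_mono Set.inter_subset_right).trans_lt measure_Ico_lt_top).ne

theorem volume_real_inter_Ico_le (s : Set ℝ) {x : ℝ} (h0 : 0 ≤ x) :
    volume.real (s ∩ Set.Ico 0 x) ≤ x := by
  refine (measureReal_mono Set.inter_subset_right measure_Ico_lt_top.ne).trans ?_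
  simp [h0]

/-- A finite measure carried by `[0,1)` whose distribution function is `c * x` is `c` times
Lebesgue measure on `[0,1)`. -/
theorem eq_smul_volume_restrict_Ico {ν : Measure ℝ} [IsFiniteMeasure ν] {c : ℝ} (hc : 0 ≤ c)
    (hsupp : ν (Set.Ico (0 : ℝ) 1)ᶜ = 0)
    (h : ∀ x, 0 ≤ x → x ≤ 1 → ν.real (Set.Ico 0 x) = c * x) :
    ν = ENNReal.ofReal c • volume.restrict (Set.Ico (0 : ℝ) 1) := by
  have hν : ν.restrict (Set.Ico (0 : ℝ) 1) = ν :=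
    Measure.restrict_eq_self_of_ae_mem (by rw [ae_iff]; exact hsupp)
  have hfin : IsFiniteMeasure (ENNReal.ofReal c • volume.restrict (Set.Ico (0 : ℝ) 1)) :=
    Measure.smul_finite _ ENNReal.ofReal_ne_top
  rw [← hν]
  refine Measure.ext_of_Ico_finite _ _ ?_ ?_
  · rw [Measure.restrict_apply_univ, ← ofReal_measureReal, h 1 zero_le_one le_rfl]
    simp
  · intro a b hab
    have key : ∀ a b : ℝ, 0 ≤ a → a ≤ b → b ≤ 1 → ν.real (Set.Ico a b) = c * (b - a) := by
      intro a b ha hab hb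
      have h2 : ν.real (Set.Ico 0 b) = ν.real (Set.Ico 0 a) + ν.real (Set.Ico a b) := by
        rw [← Set.Ico_union_Ico_eq_Ico ha hab]
        exact measureReal_union (Set.Ico_disjoint_Ico_same) measurableSet_Ico
      rw [h b (ha.trans hab) hb, h a ha (hab.trans hb)] at h2
      linarith
    rw [Measure.restrict_apply measurableSet_Ico, Measure.smul_apply,
      Measure.restrict_apply measurableSet_Ico, Set.Ico_inter_Ico, smul_eq_mul, Real.volume_Ico,
      ← ENNReal.ofReal_mul hc]
    rcases le_or_gt (max a 0) (min b 1) with hle | hlt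
    · rw [← ofReal_measureReal]
      congr 1
      exact key _ _ (le_max_right _ _) hle (min_le_right _ _)
    · rw [Set.Ico_eq_empty hlt.not_gt, measure_empty, eq_comm, ENNReal.ofReal_eq_zero]
      exact mul_nonpos_of_nonneg_of_nonpos hc (sub_nonpos.mpr hlt.le)

theorem eq_zero_of_forall_abs_le_inv_two_pow {a : ℝ} (h : ∀ n : ℕ, |a| ≤ (2 : ℝ)⁻¹ ^ n) :
    a = 0 := by
  by_contra hne
  obtain ⟨n, hn⟩ := exists_pow_lt_of_lt_one (abs_pos.mpr hne) (by norm_num : (2 : ℝ)⁻¹ < 1)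
  exact absurd (h n) hn.not_ge

theorem volume_real_preimage_TOdo_of_le_half {x : ℝ} (h0 : 0 ≤ x) (hx : x ≤ 1 / 2) :
    volume.real (TOdo ⁻¹' Set.Ico 0 x ∩ Set.Ioo 0 1) = x := by
  have : TOdo ⁻¹' Set.Ico 0 x ∩ Set.Ioo 0 1 = Set.Ico (1 / 2) (x + 1 / 2) := by
    ext r
    simp only [Set.mem_inter_iff, Set.mem_preimage, Set.mem_Ico, Set.mem_Ioo]
    constructor
    · rintro ⟨⟨_, h2⟩, h3, h4⟩
      rcases le_or_gt (1 / 2) r with h | h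
      · rw [TOdo_of_half_le h h4] at h2
        exact ⟨h, by linarith⟩
      · rw [TOdo_of_lt_half h3 h] at h2
        have := (TOdo_mem_Ico (r := 2 * r) (by linarith) (by linarith)).1
        linarith
    · rintro ⟨h1, h2⟩
      rw [TOdo_of_half_le h1 (by linarith)]
      refine ⟨⟨?_, ?_⟩, ?_, ?_⟩ <;> linarith
  rw [this, Real.volume_real_Ico_of_le (by linarith)]
  ring

theorem volume_real_preimage_TOdo_of_half_le {x : ℝ} (h0 : 1 / 2 ≤ x) :
    volume.real (TOdo ⁻¹' Set.Ico 0 x ∩ Set.Ioo 0 1) =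
      1 / 2 + volume.real (TOdo ⁻¹' Set.Ico 0 (2 * x - 1) ∩ Set.Ioo 0 1) / 2 := by
  have : TOdo ⁻¹' Set.Ico 0 x ∩ Set.Ioo 0 1 = Set.Ico (1 / 2) 1 ∪
      (fun r => 2 * r) ⁻¹' (TOdo ⁻¹' Set.Ico 0 (2 * x - 1) ∩ Set.Ioo 0 1) := by
    ext r
    simp only [Set.mem_inter_iff, Set.mem_preimage, Set.mem_Ico, Set.mem_Ioo, Set.mem_union]
    rcases le_or_gt (1 / 2) r with h | h
    · constructor
      · rintro ⟨-, -, h4⟩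
        exact Or.inl ⟨h, h4⟩
      · rintro (⟨-, h4⟩ | ⟨-, -, h4⟩)
        · rw [TOdo_of_half_le h h4]
          refine ⟨⟨?_, ?_⟩, ?_, ?_⟩ <;> linarith
        · linarith
    · constructor
      · rintro ⟨⟨h1, h2⟩, h3, h4⟩
        rw [TOdo_of_lt_half h3 h] at h2
        refine Or.inr ⟨⟨(TOdo_mem_Ico (by linarith) (by linarith)).1, ?_⟩, ?_, ?_⟩ <;> linarith
      · rintro (⟨h3, -⟩ | ⟨⟨h1, h2⟩, h3, h4⟩)
        · linarith
        · rw [TOdo_of_lt_half (by linarith) h]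
          refine ⟨⟨?_, ?_⟩, ?_, ?_⟩ <;> linarith
  have hdisj : Disjoint (Set.Ico (1 / 2 : ℝ) 1)
      ((fun r => 2 * r) ⁻¹' (TOdo ⁻¹' Set.Ico 0 (2 * x - 1) ∩ Set.Ioo 0 1)) := by
    rw [Set.disjoint_left]
    rintro r ⟨h1, -⟩ ⟨-, -, h3⟩
    simp only at h3
    linarith
  have hmeas : MeasurableSet
      ((fun r => 2 * r) ⁻¹' (TOdo ⁻¹' Set.Ico 0 (2 * x - 1) ∩ Set.Ioo 0 1)) :=
    ((measurable_TOdo measurableSet_Ico).inter measurableSet_Ioo).preimage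
      (measurable_const_mul 2)
  have hfin : volume ((fun r => 2 * r) ⁻¹' (TOdo ⁻¹' Set.Ico 0 (2 * x - 1) ∩ Set.Ioo 0 1)) ≠ ⊤ := by
    refine ((measure_mono (t := Set.Ioo (0 : ℝ) 1) ?_).trans_lt measure_Ioo_lt_top).ne
    rintro r ⟨-, h3, h4⟩
    simp only at h3 h4
    constructor <;> linarith
  rw [this, measureReal_union hdisj hmeas measure_Ico_lt_top.ne hfin,
    volume_real_preimage_two_mul, Real.volume_real_Ico_of_le (by norm_num)]
  norm_num

theorem volume_real_preimage_TOdo {x : ℝ} (h0 : 0 ≤ x) (h1 : x ≤ 1) :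
    volume.real (TOdo ⁻¹' Set.Ico 0 x ∩ Set.Ioo 0 1) = x := by
  rw [← sub_eq_zero]
  refine eq_zero_of_forall_abs_le_inv_two_pow fun n => ?_
  induction n generalizing x with
  | zero =>
    have h2 : volume.real (TOdo ⁻¹' Set.Ico 0 x ∩ Set.Ioo 0 1) ≤ 1 := by
      refine (measureReal_mono Set.inter_subset_right measure_Ioo_lt_top.ne).trans ?_
      simp
    have h3 : 0 ≤ volume.real (TOdo ⁻¹' Set.Ico 0 x ∩ Set.Ioo 0 1) := measureReal_nonneg
    rw [pow_zero, abs_le]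
    constructor <;> linarith
  | succ n ih =>
    rcases le_or_gt x (1 / 2) with h | h
    · rw [volume_real_preimage_TOdo_of_le_half h0 h, sub_self, abs_zero]
      positivity
    · rw [volume_real_preimage_TOdo_of_half_le h.le, pow_succ]
      have := abs_le.mp (ih (x := 2 * x - 1) (by linarith) (by linarith))
      rw [abs_le]
      constructor <;> linarith [this.1, this.2]

theorem restrict_Ioo_eq_restrict_Ico_unit :
    (volume : Measure ℝ).restrict (Set.Ioo 0 1) = volume.restrict (Set.Ico 0 1) :=
  Measure.restrict_congr_set Ioo_ae_eq_Ico

theorem measurePreserving_TOdo :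
    MeasurePreserving TOdo (volume.restrict (Set.Ico (0 : ℝ) 1))
      (volume.restrict (Set.Ico (0 : ℝ) 1)) := by
  refine ⟨measurable_TOdo, ?_⟩
  rw [← restrict_Ioo_eq_restrict_Ico_unit]
  have hfin : IsFiniteMeasure ((volume.restrict (Set.Ioo (0 : ℝ) 1)).map TOdo) := inferInstance
  rw [eq_smul_volume_restrict_Ico (ν := (volume.restrict (Set.Ioo (0 : ℝ) 1)).map TOdo)
    zero_le_one]
  · rw [restrict_Ioo_eq_restrict_Ico_unit]
    simp
  · rw [Measure.map_apply measurable_TOdo measurableSet_Ico.compl,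
      Measure.restrict_apply (measurable_TOdo measurableSet_Ico.compl)]
    convert measure_empty (μ := (volume : Measure ℝ))
    ext r
    simp only [Set.mem_inter_iff, Set.mem_preimage, Set.mem_compl_iff, Set.mem_empty_iff_false,
      iff_false]
    rintro ⟨h, h0, h1⟩
    exact h (TOdo_mem_Ico h0 h1)
  · intro x h0 h1
    rw [map_measureReal_apply measurable_TOdo measurableSet_Ico,
      measureReal_restrict_apply (measurable_TOdo measurableSet_Ico),
      volume_real_preimage_TOdo h0 h1, one_mul]

section Invariant

variable {s : Set ℝ}

theorem volume_real_inter_Ico_of_half_le (hs : MeasurableSet s)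
    (hinv : ∀ r, 0 < r → r < 1 → (TOdo r ∈ s ↔ r ∈ s)) {x : ℝ} (h0 : 1 / 2 ≤ x) (h1 : x ≤ 1) :
    volume.real (s ∩ Set.Ico 0 x) =
      volume.real (s ∩ Set.Ico 0 (1 / 2)) + volume.real (s ∩ Set.Ico 0 (x - 1 / 2)) := by
  have h2 : s ∩ Set.Ico (1 / 2) x = (fun r => r - 1 / 2) ⁻¹' (s ∩ Set.Ico 0 (x - 1 / 2)) := by
    ext r
    simp only [Set.mem_inter_iff, Set.mem_preimage, Set.mem_Ico, sub_nonneg, sub_lt_sub_iff_right]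
    refine and_congr_left fun h => ?_
    rw [← hinv r (by linarith) (by linarith), TOdo_of_half_le h.1 (by linarith)]
  rw [← volume_real_preimage_sub_half (s ∩ Set.Ico 0 (x - 1 / 2)), ← h2,
    ← Set.Ico_union_Ico_eq_Ico (by norm_num : (0 : ℝ) ≤ 1 / 2) h0, Set.inter_union_distrib_left,
    measureReal_union _ (hs.inter measurableSet_Ico) (volume_inter_Ico_ne_top _ _ _)
      (volume_inter_Ico_ne_top _ _ _)]
  exact (Set.Ico_disjoint_Ico_same).mono Set.inter_subset_right Set.inter_subset_right

theorem volume_real_inter_Ico_eq_half (s : Set ℝ) (x : ℝ) :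
    volume.real (s ∩ Set.Ico 0 x) =
      volume.real ((fun t => t / 2) ⁻¹' s ∩ Set.Ico 0 (2 * x)) / 2 := by
  rw [← volume_real_preimage_two_mul]
  congr 1
  ext r
  simp

theorem TOdo_mem_preimage_half_iff (hinv : ∀ r, 0 < r → r < 1 → (TOdo r ∈ s ↔ r ∈ s)) {t : ℝ}
    (h0 : 0 < t) (h1 : t < 1) :
    TOdo t ∈ (fun t => t / 2) ⁻¹' s ↔ t ∈ (fun t => t / 2) ⁻¹' s := by
  have hT := TOdo_mem_Ico h0 h1
  have ht := TOdo_of_lt_half (r := t / 2) (by linarith) (by linarith)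
  rw [mul_div_cancel₀ t two_ne_zero] at ht
  have hTT := TOdo_of_half_le (r := 1 / 2 + TOdo t / 2) (by linarith [hT.1]) (by linarith [hT.2])
  rw [add_sub_cancel_left] at hTT
  rw [Set.mem_preimage, Set.mem_preimage, ← hinv (t / 2) (by linarith) (by linarith), ht,
    ← hinv (1 / 2 + TOdo t / 2) (by linarith [hT.1]) (by linarith [hT.2]), hTT]

theorem volume_real_inter_Ico_of_invariant (hs : MeasurableSet s)
    (hinv : ∀ r, 0 < r → r < 1 → (TOdo r ∈ s ↔ r ∈ s)) {x : ℝ} (h0 : 0 ≤ x) (h1 : x ≤ 1) :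
    volume.real (s ∩ Set.Ico 0 x) = volume.real (s ∩ Set.Ico 0 1) * x := by
  rw [← sub_eq_zero]
  refine eq_zero_of_forall_abs_le_inv_two_pow fun n => ?_
  induction n generalizing s x with
  | zero =>
    have h2 := volume_real_inter_Ico_le s h0
    have h3 : 0 ≤ volume.real (s ∩ Set.Ico 0 x) := measureReal_nonneg
    have h4 := volume_real_inter_Ico_le s zero_le_one
    have h5 : 0 ≤ volume.real (s ∩ Set.Ico 0 1) := measureReal_nonneg
    rw [pow_zero, abs_le]
    constructor <;> nlinarith
  | succ n ih =>
    have hone := volume_real_inter_Ico_of_half_le hs hinv (x := 1) (by norm_num) le_rfl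
    norm_num at hone
    have hhalf := volume_real_inter_Ico_eq_half s (1 / 2)
    norm_num at hhalf
    have small : ∀ y : ℝ, 0 ≤ y → y ≤ 1 / 2 →
        |volume.real (s ∩ Set.Ico 0 y) - volume.real (s ∩ Set.Ico 0 1) * y|
          ≤ (2 : ℝ)⁻¹ ^ (n + 1) := by
      intro y hy0 hy1
      have := abs_le.mp (ih (s := (fun t => t / 2) ⁻¹' s) (x := 2 * y)
        (hs.preimage (measurable_id.div_const 2))
        (fun r hr0 hr1 => TOdo_mem_preimage_half_iff hinv hr0 hr1) (by linarith) (by linarith))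
      rw [volume_real_inter_Ico_eq_half s y, hone, hhalf, pow_succ, abs_le]
      constructor <;> linarith [this.1, this.2]
    rcases le_or_gt x (1 / 2) with h | h
    · exact small x h0 h
    · have := small (x - 1 / 2) (by linarith) (by linarith)
      rw [volume_real_inter_Ico_of_half_le hs hinv h.le h1]
      convert this using 2
      norm_num
      linarith

end Invariant

theorem ergodic_TOdo : Ergodic TOdo (volume.restrict (Set.Ico (0 : ℝ) 1)) := by
  refine ⟨measurePreserving_TOdo, ⟨fun s hs hTs => ?_⟩⟩
  have hinv : ∀ r, 0 < r → r < 1 → (TOdo r ∈ s ↔ r ∈ s) := fun r _ _ => by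
    rw [← Set.mem_preimage, hTs]
  set μ := volume.restrict (Set.Ico (0 : ℝ) 1) with hμ
  have heq : μ.restrict s = ENNReal.ofReal (volume.real (s ∩ Set.Ico 0 1)) • μ := by
    refine eq_smul_volume_restrict_Ico measureReal_nonneg ?_ fun x h0 h1 => ?_
    · rw [Measure.restrict_apply measurableSet_Ico.compl]
      refine measure_mono_null Set.inter_subset_left ?_
      rw [hμ, Measure.restrict_apply measurableSet_Ico.compl, Set.compl_inter_self, measure_empty]
    · rw [← volume_real_inter_Ico_of_invariant hs hinv h0 h1,
        measureReal_restrict_apply measurableSet_Ico, measureReal_restrict_apply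
        (measurableSet_Ico.inter hs)]
      congr 1
      ext r
      simp only [Set.mem_inter_iff, Set.mem_Ico]
      constructor
      · tauto
      · rintro ⟨h2, h3, h4⟩
        exact ⟨⟨⟨h3, h4⟩, h2⟩, h3, h4.trans_le h1⟩
  have hzero : (ENNReal.ofReal (volume.real (s ∩ Set.Ico 0 1)) • μ) sᶜ = 0 := by
    rw [← heq, Measure.restrict_apply hs.compl, Set.compl_inter_self, measure_empty]
  rw [Measure.smul_apply, smul_eq_mul, mul_eq_zero] at hzero
  rw [Filter.eventuallyConst_set]
  rcases hzero with h | h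
  · right
    rw [h, zero_smul, Measure.restrict_eq_zero] at heq
    exact measure_eq_zero_iff_ae_notMem.mp heq
  · left
    rw [ae_iff]
    exact h

theorem measurableSet_Jset (i j : ℕ) : MeasurableSet (Jset i j) :=
  measurableSet_Ico.inter ((measurable_TOdo.iterate j) measurableSet_Ico)

theorem volume_Jset (i j : ℕ) : volume (Jset i j) = (2 : ENNReal)⁻¹ ^ (2 * i + 1) := by
  have h := (measurePreserving_TOdo.iterate j).measure_preimage
    (s := Set.Ico (0 : ℝ) ((2 : ℝ)⁻¹ ^ (2 * i + 1))) measurableSet_Ico.nullMeasurableSet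
  rw [Measure.restrict_apply ((measurable_TOdo.iterate j) measurableSet_Ico), Set.inter_comm] at h
  have hle : (2 : ℝ)⁻¹ ^ (2 * i + 1) ≤ 1 := pow_le_one₀ (by norm_num) (by norm_num)
  rw [Jset, h, Measure.restrict_apply measurableSet_Ico,
    Set.inter_eq_left.mpr (Set.Ico_subset_Ico_right hle), Real.volume_Ico, sub_zero,
    ENNReal.ofReal_pow (by norm_num), ENNReal.ofReal_inv_of_pos two_pos]
  norm_num

theorem Cset_succ (i : ℕ) : Cset (i + 1) = ⋃ j ∈ Finset.range (2 ^ (i + 1)), Jset (i + 1) j := by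
  have h : Finset.range (2 ^ (i + 1)) =
      Finset.range (2 ^ i) ∪ Finset.Ico (2 ^ i) (2 ^ (i + 1)) := by
    ext j
    have : 2 ^ i ≤ 2 ^ (i + 1) := Nat.pow_le_pow_right two_pos (Nat.le_succ i)
    simp only [Finset.mem_range, Finset.mem_union, Finset.mem_Ico]
    omega
  rw [h, Finset.set_biUnion_union]
  rfl

theorem Jset_succ_subset (i j : ℕ) : Jset (i + 1) j ⊆ Jset i j := by
  refine Set.inter_subset_inter_right _ (Set.preimage_mono (Set.Ico_subset_Ico_right ?_))
  exact pow_le_pow_of_le_one (by norm_num) (by norm_num) (by omega)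

theorem Aset_succ_subset (i : ℕ) : Aset (i + 1) ⊆ Cset i := by
  cases i with
  | zero =>
    intro r hr
    simp only [Aset, pow_zero, Finset.range_one, Finset.mem_singleton, Set.iUnion_iUnion_eq_left,
      Jset, Function.iterate_zero] at hr
    refine Or.inr ⟨hr.1.1, hr.2.2.trans ?_⟩
    norm_num
  | succ i =>
    rw [Cset_succ]
    exact Set.iUnion₂_mono fun j _ => Jset_succ_subset (i + 1) j

theorem CsetAll_eq_iUnion_Bset : CsetAll = ⋃ i, Bset i := by
  refine subset_antisymm (Set.iUnion_subset fun i => ?_)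
    (Set.iUnion_mono fun i => Set.subset_union_right)
  induction i with
  | zero =>
    refine Set.union_subset (Set.empty_subset _) (Set.subset_iUnion Bset 0)
  | succ i ih =>
    exact Set.union_subset ((Aset_succ_subset i).trans ih) (Set.subset_iUnion Bset (i + 1))

theorem measurableSet_Bset (i : ℕ) : MeasurableSet (Bset i) := by
  cases i with
  | zero => exact measurableSet_Ico
  | succ i => exact Finset.measurableSet_biUnion _ fun j _ => measurableSet_Jset _ _

theorem measurableSet_CsetAll : MeasurableSet CsetAll := by
  rw [CsetAll_eq_iUnion_Bset]
  exact MeasurableSet.iUnion measurableSet_Bset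

theorem volume_CsetAll_le : volume CsetAll ≤ ENNReal.ofReal (1 / 2) := by
  have hB : ∀ i, volume (Bset (i + 1)) ≤ ENNReal.ofReal (1 / 4 / 2 / 2 ^ i) := by
    intro i
    refine (measure_biUnion_finset_le _ _).trans ?_
    simp only [volume_Jset]
    rw [Finset.sum_const, Nat.card_Ico, nsmul_eq_mul]
    have h2 : (2 : ENNReal)⁻¹ = ENNReal.ofReal 2⁻¹ := by
      rw [ENNReal.ofReal_inv_of_pos two_pos]; norm_num
    rw [h2, ← ENNReal.ofReal_pow (by norm_num), ← ENNReal.ofReal_natCast,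
      ← ENNReal.ofReal_mul (Nat.cast_nonneg _)]
    refine ENNReal.ofReal_le_ofReal (le_of_eq ?_)
    have h3 : 2 ^ (i + 1) - 2 ^ i = 2 ^ i := by rw [pow_succ]; omega
    rw [h3]
    push_cast
    rw [show 2 * (i + 1) + 1 = i + i + 3 by ring, pow_add, pow_add, inv_pow]
    field_simp
    norm_num
  rw [CsetAll_eq_iUnion_Bset]
  refine (measure_iUnion_le _).trans ?_
  rw [tsum_eq_zero_add' ENNReal.summable]
  have hsum : ∑' i : ℕ, volume (Bset (i + 1)) ≤ ENNReal.ofReal (1 / 4) := by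
    refine (ENNReal.tsum_le_tsum hB).trans ?_
    rw [← ENNReal.ofReal_tsum_of_nonneg (fun i => by positivity) (summable_geometric_two' _),
      tsum_geometric_two']
  have h0 : volume (Bset 0) = ENNReal.ofReal (1 / 4) := by
    rw [Bset, Real.volume_Ico, sub_zero]
  rw [h0]
  refine (add_le_add_right hsum _).trans ?_
  rw [← ENNReal.ofReal_add (by norm_num) (by norm_num)]
  norm_num

/-- With `Y n ω = 1` if `T^n ω ∈ C` and `0` otherwise: the driving odometer is
ergodic and measure preserving (so `(Y_n)` is a stationary ergodic process),
`(Y_n)` is binary valued, `E[Y 1] ≤ 1/2`, and for `ω ∈ A_i` the whole backward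
orbit segment of length `2^{i-1}` lies in `C` (i.e. `Y_0(ω) = Y_{-1}(ω) = ⋯ =
Y_{-(2^{i-1}-1)}(ω) = 1`, the backward images being the `T^[j]`-preimages of
`ω` within `[0,1)`). -/
theorem stmt_15 (Y : ℕ → ℝ → ℝ)
    (hY : ∀ n ω, Y n ω = Set.indicator CsetAll (fun _ => (1 : ℝ)) (TOdo^[n] ω)) :
    Ergodic TOdo (volume.restrict (Set.Ico (0 : ℝ) 1)) ∧
    (∀ n ω, Y n ω = 0 ∨ Y n ω = 1) ∧
    (∫ ω, Y 1 ω ∂(volume.restrict (Set.Ico (0 : ℝ) 1))) ≤ 1 / 2 ∧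
    (∀ i, 1 ≤ i → ∀ ω ∈ Aset i, ∀ j, j < 2 ^ (i - 1) →
      ∀ ω' ∈ Set.Ico (0 : ℝ) 1, TOdo^[j] ω' = ω → ω' ∈ CsetAll) := by
  have hYeq : ∀ n, Y n = (TOdo^[n] ⁻¹' CsetAll).indicator fun _ => (1 : ℝ) :=
    fun n => funext fun ω => hY n ω
  refine ⟨ergodic_TOdo, fun n ω => ?_, ?_, ?_⟩
  · rw [hY]
    by_cases h : TOdo^[n] ω ∈ CsetAll
    · exact Or.inr (Set.indicator_of_mem h _)
    · exact Or.inl (Set.indicator_of_notMem h _)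
  · rw [hYeq, integral_indicator_const _ ((measurable_TOdo.iterate 1) measurableSet_CsetAll),
      smul_eq_mul, mul_one, Measure.real, (measurePreserving_TOdo.iterate 1).measure_preimage
      measurableSet_CsetAll.nullMeasurableSet]
    exact ENNReal.toReal_le_of_le_ofReal (by norm_num)
      ((Measure.restrict_apply_le _ _).trans volume_CsetAll_le)
  · intro i hi ω hω j hj ω' hω' hT
    obtain ⟨k, rfl⟩ := Nat.exists_eq_add_of_le' hi
    rw [Nat.add_sub_cancel] at hj
    simp only [Aset, Set.mem_iUnion, Finset.mem_range] at hω
    obtain ⟨l, hl, -, hmem⟩ := hω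
    refine Set.mem_iUnion.mpr ⟨k + 1, ?_⟩
    rw [Cset_succ]
    simp only [Set.mem_iUnion, Finset.mem_range]
    refine ⟨l + j, by rw [pow_succ]; omega, hω', ?_⟩
    rwa [Set.mem_preimage, Function.iterate_add_apply, hT]
end

section
/- There exists a stationary ergodic binary-valued process (Y_n) with E[Y_1] ≤ 1/2 such that, with service rate s = 3/4, the stationary queue length Q = sup_{n≥0}(Σ_{j=0}^{n-1} Y_{-j} - (3/4)n) is a.s. finite but its tail is heavier than every exponential: for every δ > 0 there exists q > 0 with P(Q > q) > e^{-δq}. -/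
open MeasureTheory Filter

/-- The workload after `n` steps of the queue with net input `f ∘ T^[n-1], …, f ∘ T, f`,
started empty. -/
def backwardQueue {X : Type*} (T : X → X) (f : X → ℝ) : ℕ → X → ℝ
  | 0 => fun _ => 0
  | n + 1 => fun x => max 0 (f x + backwardQueue T f n (T x))

section BackwardQueue

variable {X : Type*} {T : X → X} {f : X → ℝ}

lemma backwardQueue_nonneg (n : ℕ) (x : X) : 0 ≤ backwardQueue T f n x := by
  cases n with
  | zero => exact le_rfl
  | succ n => exact le_max_left _ _

lemma backwardQueue_le_succ (n : ℕ) (x : X) :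
    backwardQueue T f n x ≤ backwardQueue T f (n + 1) x := by
  induction n generalizing x with
  | zero => exact backwardQueue_nonneg 1 x
  | succ n ih => exact max_le_max le_rfl (add_le_add le_rfl (ih (T x)))

lemma monotone_backwardQueue (x : X) : Monotone fun n => backwardQueue T f n x :=
  monotone_nat_of_le_succ fun n => backwardQueue_le_succ n x

lemma birkhoffSum_le_backwardQueue (n : ℕ) (x : X) :
    birkhoffSum T f n x ≤ backwardQueue T f n x := by
  induction n generalizing x with
  | zero => exact le_rfl
  | succ n ih =>
    rw [birkhoffSum_succ']
    exact (add_le_add le_rfl (ih (T x))).trans (le_max_right _ _)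

lemma tendsto_backwardQueue_atTop {x : X}
    (hx : ¬ BddAbove (Set.range fun n => birkhoffSum T f n x)) :
    Tendsto (fun n => backwardQueue T f n x) atTop atTop := by
  refine tendsto_atTop_atTop_of_monotone (monotone_backwardQueue x) fun b => ?_
  obtain ⟨_, ⟨n, rfl⟩, hn⟩ := not_bddAbove_iff.1 hx b
  exact ⟨n, hn.le.trans (birkhoffSum_le_backwardQueue n x)⟩

lemma backwardQueue_succ_sub (n : ℕ) (x : X) :
    backwardQueue T f (n + 1) x - backwardQueue T f n (T x) =
      max (-backwardQueue T f n (T x)) (f x) := by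
  simp only [backwardQueue]
  rw [← max_sub_sub_right]
  simp

lemma bddAbove_range_birkhoffSum_map_iff (x : X) :
    BddAbove (Set.range fun n => birkhoffSum T f n (T x)) ↔
      BddAbove (Set.range fun n => birkhoffSum T f n x) := by
  constructor
  · rintro ⟨b, hb⟩
    refine ⟨max 0 (f x + b), ?_⟩
    rintro _ ⟨n, rfl⟩
    cases n with
    | zero => simp
    | succ n =>
      simp only [birkhoffSum_succ']
      exact le_max_of_le_right (add_le_add le_rfl (hb ⟨n, rfl⟩))
  · rintro ⟨b, hb⟩
    refine ⟨b - f x, ?_⟩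
    rintro _ ⟨n, rfl⟩
    have := hb ⟨n + 1, rfl⟩
    simp only [birkhoffSum_succ'] at this
    simp only
    linarith

variable [MeasurableSpace X] {μ : Measure X}

lemma integrable_backwardQueue (hT : MeasurePreserving T μ μ) (hf : Integrable f μ) (n : ℕ) :
    Integrable (backwardQueue T f n) μ := by
  induction n with
  | zero => exact integrable_zero _ _ _
  | succ n ih =>
    exact (integrable_zero X ℝ μ).sup (hf.add (hT.integrable_comp_of_integrable ih))

/-- Loynes' stability theorem: partial sums with negative drift over an ergodic system are almost
surely bounded above. -/
theorem Ergodic.ae_bddAbove_birkhoffSum (hT : Ergodic T μ) (hfm : Measurable f)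
    (hf : Integrable f μ) (hneg : ∫ x, f x ∂μ < 0) :
    ∀ᵐ x ∂μ, BddAbove (Set.range fun n => birkhoffSum T f n x) := by
  have hTμ := hT.toMeasurePreserving
  have hmeas : ∀ n, Measurable fun x => birkhoffSum T f n x := fun n => by
    unfold birkhoffSum
    exact Finset.measurable_sum _ fun k _ => hfm.comp (hTμ.measurable.iterate k)
  refine (hT.toPreErgodic.ae_mem_or_ae_notMem (measurableSet_bddAbove_range hmeas)
    (Set.ext fun x => bddAbove_range_birkhoffSum_map_iff x)).resolve_right fun hunb => ?_
  have hlim : Tendsto (fun n => ∫ x, max (-backwardQueue T f n (T x)) (f x) ∂μ) atTop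
      (nhds (∫ x, f x ∂μ)) := by
    have hint n := hTμ.integrable_comp_of_integrable (integrable_backwardQueue hTμ hf n)
    refine tendsto_integral_of_dominated_convergence (fun x => |f x|)
      (fun n => ((hint n).neg.sup hf).aestronglyMeasurable) hf.abs (fun n => ?_) ?_
    · refine Eventually.of_forall fun x => ?_
      have := backwardQueue_nonneg (T := T) (f := f) n (T x)
      rw [Real.norm_eq_abs]
      rcases le_total 0 (f x) with h | h
      · rw [max_eq_right (by linarith)]
      · rw [abs_of_nonpos h, abs_of_nonpos (max_le (by linarith) h)]
        exact neg_le_neg (le_max_right _ _)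
    · filter_upwards [hunb] with x hx
      have hTx := tendsto_backwardQueue_atTop
        (mt (bddAbove_range_birkhoffSum_map_iff (T := T) (f := f) x).1 hx)
      refine tendsto_const_nhds.congr' ?_
      filter_upwards [hTx.eventually_ge_atTop (-f x)] with n hn
      rw [max_eq_right (by linarith)]
  refine hneg.not_ge (ge_of_tendsto' hlim fun n => ?_)
  have hn := integrable_backwardQueue hTμ hf n
  have hnT : Integrable (fun x => backwardQueue T f n (T x)) μ :=
    hTμ.integrable_comp_of_integrable hn
  simp_rw [← backwardQueue_succ_sub]
  have hcomp : ∫ x, backwardQueue T f n (T x) ∂μ = ∫ x, backwardQueue T f n x ∂μ := by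
    rw [← integral_map hTμ.aemeasurable (by rw [hTμ.map_eq]; exact hn.aestronglyMeasurable),
      hTμ.map_eq]
  rw [integral_sub (integrable_backwardQueue hTμ hf (n + 1)) hnT, hcomp, sub_nonneg]
  exact integral_mono hn (integrable_backwardQueue hTμ hf (n + 1)) (backwardQueue_le_succ n)

end BackwardQueue

/-- A union of orbit segments of length `2 ^ k` of rotation by `a`, issued from arcs of length
`8⁻¹ ^ (k + 1)`. -/
def burstSet (a : UnitAddCircle) : Set UnitAddCircle :=
  ⋃ k : ℕ, ⋃ j ∈ Finset.range (2 ^ k),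
    (fun x => x + j • a) ⁻¹' Metric.closedBall 0 ((8⁻¹ : ℝ) ^ (k + 1) / 2)

lemma volume_closedBall_burst (k : ℕ) :
    volume (Metric.closedBall (0 : UnitAddCircle) ((8⁻¹ : ℝ) ^ (k + 1) / 2)) =
      ENNReal.ofReal ((8⁻¹ : ℝ) ^ (k + 1)) := by
  rw [AddCircle.volume_closedBall, mul_div_cancel₀ _ two_ne_zero, min_eq_right]
  exact pow_le_one₀ (by norm_num) (by norm_num)

lemma measurableSet_burstSet (a : UnitAddCircle) : MeasurableSet (burstSet a) :=
  MeasurableSet.iUnion fun _ => Finset.measurableSet_biUnion _ fun _ _ =>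
    measurable_add_const _ Metric.isClosed_closedBall.measurableSet

lemma volume_burstSet_le (a : UnitAddCircle) : volume (burstSet a) ≤ ENNReal.ofReal (1 / 2) := by
  have hs : HasSum (fun k : ℕ => (8⁻¹ : ℝ) * 4⁻¹ ^ k) (8⁻¹ * (1 - 4⁻¹)⁻¹) :=
    (hasSum_geometric_of_lt_one (by norm_num) (by norm_num)).mul_left _
  calc volume (burstSet a)
      ≤ ∑' k : ℕ, ENNReal.ofReal ((8⁻¹ : ℝ) * 4⁻¹ ^ k) := by
        refine (measure_iUnion_le _).trans (ENNReal.tsum_le_tsum fun k => ?_)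
        refine (measure_biUnion_finset_le _ _).trans ?_
        simp_rw [measure_preimage_add_right, volume_closedBall_burst]
        rw [Finset.sum_const, Finset.card_range, ← ENNReal.ofReal_nsmul]
        refine ENNReal.ofReal_le_ofReal (le_of_eq ?_)
        rw [nsmul_eq_mul, pow_succ, mul_comm _ (8⁻¹ : ℝ), mul_left_comm, Nat.cast_pow, ← mul_pow]
        norm_num
    _ = ENNReal.ofReal (8⁻¹ * (1 - 4⁻¹)⁻¹) := by
        rw [← ENNReal.ofReal_tsum_of_nonneg (fun k => by positivity) hs.summable, hs.tsum_eq]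
    _ ≤ ENNReal.ofReal (1 / 2) := ENNReal.ofReal_le_ofReal (by norm_num)

lemma sub_nsmul_mem_burstSet {a x : UnitAddCircle} {k j : ℕ}
    (hx : x ∈ Metric.closedBall (0 : UnitAddCircle) ((8⁻¹ : ℝ) ^ (k + 1) / 2)) (hj : j < 2 ^ k) :
    x - j • a ∈ burstSet a := by
  simp only [burstSet, Set.mem_iUnion]
  exact ⟨k, j, Finset.mem_range.2 hj, by simpa using hx⟩

lemma exists_exp_neg_two_pow_lt {δ : ℝ} (hδ : 0 < δ) :
    ∃ k : ℕ, Real.exp (-δ * (2 ^ k / 8)) < (8⁻¹ : ℝ) ^ (k + 1) := by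
  have h := ((tendsto_pow_atTop_atTop_of_one_lt (one_lt_two (α := ℝ))).const_mul_atTop
    (show 0 < δ / 8 by positivity))
  have h3 := ((Real.tendsto_pow_mul_exp_neg_atTop_nhds_zero 3).comp h).const_mul (8 * (8 / δ) ^ 3)
  rw [mul_zero] at h3
  obtain ⟨k, hk⟩ := (h3.eventually_lt_const one_pos).exists
  refine ⟨k, ?_⟩
  have h8 : (8 : ℝ) * (8 / δ) ^ 3 * (δ / 8 * 2 ^ k) ^ 3 = 8 ^ (k + 1) := by
    have : (8 : ℝ) ^ k = (2 ^ k) ^ 3 := by rw [← pow_mul, mul_comm, pow_mul]; norm_num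
    rw [pow_succ (8 : ℝ) k, this]
    field_simp
  simp only [Function.comp_apply, ← mul_assoc] at hk
  rw [h8, show -(δ / 8 * 2 ^ k) = -δ * (2 ^ k / 8) by ring] at hk
  rw [inv_pow, lt_inv_comm₀ (Real.exp_pos _) (by positivity), ← one_div,
    lt_div_iff₀ (Real.exp_pos _)]
  exact hk

/-- The indicator of `C` read along the orbit of rotation by `a`. -/
noncomputable def rotationCode (a : UnitAddCircle) (C : Set UnitAddCircle) (x : UnitAddCircle) :
    ℤ → ℝ :=
  fun i => C.indicator 1 (x + i • a)

lemma measurable_rotationCode (a : UnitAddCircle) {C : Set UnitAddCircle} (hC : MeasurableSet C) :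
    Measurable (rotationCode a C) :=
  measurable_pi_lambda _ fun i => (measurable_one.indicator hC).comp (measurable_add_const (i • a))

lemma rotationCode_neg_sum (a : UnitAddCircle) (C : Set UnitAddCircle) (x : UnitAddCircle)
    (n : ℕ) :
    (∑ j ∈ Finset.range n, rotationCode a C x (-(j : ℤ))) - (3 / 4 : ℝ) * n =
      birkhoffSum (· + -a) (fun y => C.indicator 1 y - 3 / 4) n x := by
  simp only [birkhoffSum, Finset.sum_sub_distrib, Finset.sum_const, Finset.card_range,
    nsmul_eq_mul, mul_comm, rotationCode]
  congr 2 with j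
  simp

lemma exists_ergodic_rotation :
    ∃ a : UnitAddCircle, Ergodic (· + a) ∧ Ergodic (· + -a) := by
  have h : addOrderOf ((√2 : ℝ) : UnitAddCircle) = 0 := by
    rw [← AddCircle.denseRange_zsmul_iff, AddCircle.denseRange_zsmul_coe_iff]
    simpa using irrational_sqrt_two
  exact ⟨_, AddCircle.ergodic_add_right.2 h, AddCircle.ergodic_add_right.2 (by simpa using h)⟩

/-- There exists a stationary ergodic binary-valued process (realized as the
coordinate process on `ℤ → ℝ` under an ergodic shift-invariant probability
measure `μ`) with `E[Y 1] ≤ 1/2` such that, for service rate `s = 3/4`, the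
stationary queue length `Q = sup_{n ≥ 0} (∑_{j=0}^{n-1} Y_{-j} - (3/4) n)` is
a.s. finite, but for every `δ > 0` there is `q > 0` with
`P(Q > q) > e^{-δ q}`. -/
theorem stmt_16 :
    ∃ μ : Measure (ℤ → ℝ), IsProbabilityMeasure μ ∧
      Ergodic (fun z : ℤ → ℝ => fun i => z (i + 1)) μ ∧
      (∀ᵐ z ∂μ, ∀ i, z i = 0 ∨ z i = 1) ∧
      (∫ z : ℤ → ℝ, z 1 ∂μ) ≤ 1 / 2 ∧
      (∀ᵐ z ∂μ, BddAbove (Set.range fun n : ℕ =>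
        (∑ j ∈ Finset.range n, z (-(j : ℤ))) - (3 / 4 : ℝ) * (n : ℝ))) ∧
      ∀ δ : ℝ, 0 < δ → ∃ q : ℝ, 0 < q ∧
        μ {z | q < ⨆ n : ℕ, ((∑ j ∈ Finset.range n, z (-(j : ℤ))) - (3 / 4 : ℝ) * (n : ℝ))}
          > ENNReal.ofReal (Real.exp (-δ * q)) := by
  have : IsProbabilityMeasure (volume : Measure UnitAddCircle) := ⟨UnitAddCircle.measure_univ⟩
  obtain ⟨a, hpos, hneg⟩ := exists_ergodic_rotation
  have hC := measurableSet_burstSet a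
  have hΦ := measurable_rotationCode a hC
  have hvol : volume.real (burstSet a) ≤ 1 / 2 :=
    ENNReal.toReal_le_of_le_ofReal (by norm_num) (volume_burstSet_le a)
  have hint : Integrable ((burstSet a).indicator (1 : UnitAddCircle → ℝ)) :=
    (integrable_const 1).indicator hC
  have hbdd := hneg.ae_bddAbove_birkhoffSum
    (f := fun y => (burstSet a).indicator 1 y - 3 / 4)
    ((measurable_one.indicator hC).sub_const _) (hint.sub (integrable_const _)) (by
      rw [integral_sub hint (integrable_const _), integral_indicator_one hC]
      simp only [integral_const, probReal_univ, smul_eq_mul]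
      linarith)
  simp_rw [← rotationCode_neg_sum] at hbdd
  refine ⟨volume.map (rotationCode a (burstSet a)), Measure.isProbabilityMeasure_map
    hΦ.aemeasurable, ?_, ?_, ?_, ?_, fun δ hδ => ?_⟩
  · refine hΦ.measurePreserving volume |>.ergodic_of_ergodic_semiconj hpos (by fun_prop) ?_
    intro x
    ext i
    simp only [rotationCode]
    congr 1
    rw [add_smul, one_smul]
    abel
  · rw [ae_map_iff hΦ.aemeasurable]
    · refine Eventually.of_forall fun x i => ?_
      exact (Set.indicator_eq_zero_or_self (burstSet a) 1 (x + i • a))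
    · simp only [Set.ofPred_forall]
      refine MeasurableSet.iInter fun i => ?_
      exact (measurableSet_eq_fun (measurable_pi_apply i) measurable_const).union
        (measurableSet_eq_fun (measurable_pi_apply i) measurable_const)
  · rw [integral_map hΦ.aemeasurable (measurable_pi_apply 1).aestronglyMeasurable]
    simp only [rotationCode]
    rw [integral_add_right_eq_self (fun x => (burstSet a).indicator (1 : UnitAddCircle → ℝ) x),
      integral_indicator_one hC]
    exact hvol
  · rw [ae_map_iff hΦ.aemeasurable]
    · exact hbdd
    · exact measurableSet_bddAbove_range fun n => by fun_prop
  · obtain ⟨k, hk⟩ := exists_exp_neg_two_pow_lt hδ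
    refine ⟨2 ^ k / 8, by positivity, ?_⟩
    refine lt_of_lt_of_le ((ENNReal.ofReal_lt_ofReal_iff (by positivity)).2 hk) ?_
    rw [← volume_closedBall_burst]
    refine le_trans (measure_mono_ae ?_) (Measure.le_map_apply hΦ.aemeasurable _)
    filter_upwards [hbdd] with x hx hxI
    refine lt_of_lt_of_le ?_ (le_ciSup hx (2 ^ k))
    have hone : ∀ j ∈ Finset.range (2 ^ k),
        rotationCode a (burstSet a) x (-(j : ℤ)) = 1 := fun j hj => by
      have := sub_nsmul_mem_burstSet (a := a) hxI (Finset.mem_range.1 hj)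
      rw [sub_eq_add_neg] at this
      simp [rotationCode, this]
    rw [Finset.sum_congr rfl hone]
    have : (0 : ℝ) < 2 ^ k := by positivity
    simp only [Finset.sum_const, Finset.card_range, nsmul_eq_mul, mul_one, Nat.cast_pow,
      Nat.cast_ofNat]
    linarith
end
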